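/- arXiv:2508.20968 — 5 statements merged into one kernel-verified Lean document; each statement's English description precedes it below -/
import Mathlib

section
/- Let f : (0, ∞) → (0, ∞) be defined by f(y) = y + y^{1/2}, and for n ∈ ℕ let f^n denote the n-th iterate of f. Then there exists y₀ > 0 such that for all y > y₀ and all n ∈ ℕ one has f^n(y) ≤ y + n² y^{2/3}. -/
open Filter

/-- The map `f(y) = y + √y` from part 1 of the cumulative-displacement lemma. -/
noncomputable def cumulF (y : ℝ) : ℝ := y + Real.sqrt y

theorem cumulF_monotone : Monotone cumulF := fun _ _ h =>
  add_le_add h (Real.sqrt_le_sqrt h)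

theorem cumulF_iterate_le_sq {y : ℝ} (hy : 0 ≤ y) (n : ℕ) :
    cumulF^[n] y ≤ (√y + n / 2) ^ 2 := by
  induction n with
  | zero => simp [Real.sq_sqrt hy]
  | succ n ih =>
    rw [Function.iterate_succ_apply']
    refine (cumulF_monotone ih).trans ?_
    rw [cumulF, Real.sqrt_sq (by positivity)]
    push_cast
    linarith

theorem sqrt_add_quarter_le_rpow {y : ℝ} (hy : 64 ≤ y) :
    √y + 1 / 4 ≤ y ^ ((2 : ℝ) / 3) := by
  have hy0 : 0 ≤ y := by linarith
  obtain ⟨t, ht⟩ : ∃ t, t = y ^ ((1 : ℝ) / 6) := ⟨_, rfl⟩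
  have ht2 : 2 ≤ t := by
    rw [ht, one_div, Real.le_rpow_inv_iff_of_pos two_pos.le hy0 (by norm_num)]
    norm_num
    exact hy
  have h3 : √y = t ^ 3 := by
    rw [ht, Real.sqrt_eq_rpow, ← Real.rpow_mul_natCast hy0]
    norm_num
  have h4 : y ^ ((2 : ℝ) / 3) = t ^ 4 := by
    rw [ht, ← Real.rpow_mul_natCast hy0]
    norm_num
  rw [h3, h4]
  have : (2 : ℝ) ^ 3 ≤ t ^ 3 := by gcongr
  nlinarith

/-- Part 1 of the cumulative-displacement lemma: there is `y₀ > 0` such that for all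
`y > y₀` and all `n ∈ ℕ`, `f^n(y) ≤ y + n² y^{2/3}`, where `f(y) = y + y^{1/2}`. -/
theorem cumulF_iterate_le :
    ∃ y₀ : ℝ, 0 < y₀ ∧ ∀ y : ℝ, y₀ < y → ∀ n : ℕ,
      cumulF^[n] y ≤ y + (n : ℝ) ^ 2 * y ^ ((2 : ℝ) / 3) := by
  refine ⟨64, by norm_num, fun y hy n => ?_⟩
  have hy0 : 0 ≤ y := by linarith
  have hn : (n : ℝ) ≤ (n : ℝ) ^ 2 := by exact_mod_cast Nat.le_self_pow two_ne_zero n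
  calc cumulF^[n] y ≤ (√y + n / 2) ^ 2 := cumulF_iterate_le_sq hy0 n
    _ = y + n * √y + (n : ℝ) ^ 2 * (1 / 4) := by
      rw [add_sq, Real.sq_sqrt hy0]
      ring
    _ ≤ y + (n : ℝ) ^ 2 * √y + (n : ℝ) ^ 2 * (1 / 4) := by gcongr
    _ = y + (n : ℝ) ^ 2 * (√y + 1 / 4) := by ring
    _ ≤ y + (n : ℝ) ^ 2 * y ^ ((2 : ℝ) / 3) := by
      gcongr
      exact sqrt_add_quarter_le_rpow hy.le
end

section
/- Let g : (0, ∞) → ℝ be defined by g(y) = y − y^{1/2}. Then there exists y₀ > 0 such that for all y > y₀ and all n ∈ ℕ satisfying n < y^{1/6} − 1, the iterates g(y), g²(y), …, g^n(y) are all well-defined (i.e., each intermediate iterate is positive) and g^n(y) ≥ y − n² y^{2/3}. -/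
/-- The map `g(y) = y - √y` from part 2 of the cumulative-displacement lemma. -/
noncomputable def cumulG (y : ℝ) : ℝ := y - Real.sqrt y

/-- Every iterate of `cumulG` stays below its starting point and loses at most `√y` per step. -/
theorem cumulG_iterate_bounds (y : ℝ) (k : ℕ) :
    y - k * √y ≤ cumulG^[k] y ∧ cumulG^[k] y ≤ y := by
  induction k with
  | zero => simp
  | succ k ih =>
    obtain ⟨hlower, hupper⟩ := ih
    have hsqrt := Real.sqrt_le_sqrt hupper
    have hnonneg := Real.sqrt_nonneg (cumulG^[k] y)
    rw [Function.iterate_succ_apply', cumulG]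
    push_cast
    constructor <;> linarith

/-- Part 2 of the cumulative-displacement lemma: there is `y₀ > 0` such that for all
`y > y₀` and all `n ∈ ℕ` with `n < y^{1/6} - 1`, the iterates `g(y), …, g^n(y)`
are all well-defined (each intermediate iterate is positive) and
`g^n(y) ≥ y - n² y^{2/3}`, where `g(y) = y - y^{1/2}`. -/
theorem cumulG_iterate_ge :
    ∃ y₀ : ℝ, 0 < y₀ ∧ ∀ y : ℝ, y₀ < y → ∀ n : ℕ,
      (n : ℝ) < y ^ ((1 : ℝ) / 6) - 1 →
      (∀ k ≤ n, 0 < cumulG^[k] y) ∧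
      y - (n : ℝ) ^ 2 * y ^ ((2 : ℝ) / 3) ≤ cumulG^[n] y := by
  refine ⟨1, one_pos, fun y hy n hn => ?_⟩
  have hy0 : 0 ≤ y := by linarith
  set x := y ^ ((1 : ℝ) / 6) with hx
  have hx1 : 1 ≤ x := Real.one_le_rpow hy.le (by norm_num)
  have hpow : x ^ 6 = y := by
    rw [hx, ← Real.rpow_mul_natCast hy0]
    norm_num
  have hsqrt : √y = x ^ 3 := by
    rw [hx, ← Real.rpow_mul_natCast hy0, Real.sqrt_eq_rpow]
    norm_num
  have htwo_thirds : y ^ ((2 : ℝ) / 3) = x ^ 4 := by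
    rw [hx, ← Real.rpow_mul_natCast hy0]
    norm_num
  constructor
  · intro k hk
    have hkx : (k : ℝ) < x := by
      have : (k : ℝ) ≤ n := by exact_mod_cast hk
      linarith
    have hlt : (k : ℝ) * √y < y :=
      calc (k : ℝ) * √y = k * x ^ 3 := by rw [hsqrt]
        _ < x * x ^ 3 := by gcongr
        _ = x ^ 4 := by ring
        _ ≤ x ^ 6 := pow_le_pow_right₀ hx1 (by norm_num)
        _ = y := hpow
    linarith [(cumulG_iterate_bounds y k).1]
  · have hle : (n : ℝ) * √y ≤ (n : ℝ) ^ 2 * y ^ ((2 : ℝ) / 3) := by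
      rw [hsqrt, htwo_thirds]
      have hn2 : (n : ℝ) ≤ (n : ℝ) ^ 2 := by exact_mod_cast Nat.le_self_pow two_ne_zero n
      exact mul_le_mul hn2 (pow_le_pow_right₀ hx1 (by norm_num)) (by positivity) (by positivity)
    linarith [(cumulG_iterate_bounds y n).1]
end

section
/- Let U ⊆ ℝ² be an open set containing the closed unit square [0,1]², and let b = (b₁, b₂), σ₁ = (σ₁₁, σ₁₂), σ₂ = (σ₂₁, σ₂₂) be twice continuously differentiable vector fields U → ℝ². Assume the tangency conditions: b₂, σ₁₂, σ₂₂ vanish on the bottom edge [0,1] × {0}, and b₁, σ₁₁, σ₂₁ vanish on the left edge {0} × [0,1]. For i ∈ {1,2}, let i′ denote the other index, and for x = (x₁, x₂) ∈ (0,1)² define G_i(x) = b_i(x)/x_i + (1/2) Σ_{m=1}^{2} [ ∂_{i′}σ_{m i}(x) σ_{m i′}(x)/x_i + ∂_i σ_{m i}(x) σ_{m i}(x)/x_i − σ_{m i}(x)²/x_i² ], which is the value at x of the diffusion generator applied to the function ln ∘ x_i. Then, with λ_i = ∂_i b_i(0,0), for every ε > 0 there exists δ > 0 such that for all x ∈ (0,1)²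 with x₁ + x₂ < δ one has |G_i(x) − λ_i| < ε for i = 1, 2. -/
open Set

/-- First partial derivative `∂₁ f` of a function of two real variables. -/
noncomputable def pd1 (f : ℝ × ℝ → ℝ) (x : ℝ × ℝ) : ℝ := fderiv ℝ f x (1, 0)

/-- Second partial derivative `∂₂ f` of a function of two real variables. -/
noncomputable def pd2 (f : ℝ × ℝ → ℝ) (x : ℝ × ℝ) : ℝ := fderiv ℝ f x (0, 1)

/-- The value `G₁(x)` of the diffusion generator applied to `ln ∘ x₁`:
`G₁(x) = b₁(x)/x₁ + (1/2) Σ_m [∂₂σ_{m1}(x) σ_{m2}(x)/x₁ + ∂₁σ_{m1}(x) σ_{m1}(x)/x₁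
 − σ_{m1}(x)²/x₁²]`. -/
noncomputable def genLog1 (b1 s11 s12 s21 s22 : ℝ × ℝ → ℝ) (x : ℝ × ℝ) : ℝ :=
  b1 x / x.1 + (1 / 2) *
    ((pd2 s11 x * s12 x / x.1 + pd1 s11 x * s11 x / x.1 - s11 x ^ 2 / x.1 ^ 2)
      + (pd2 s21 x * s22 x / x.1 + pd1 s21 x * s21 x / x.1 - s21 x ^ 2 / x.1 ^ 2))

/-- The value `G₂(x)` of the diffusion generator applied to `ln ∘ x₂`:
`G₂(x) = b₂(x)/x₂ + (1/2) Σ_m [∂₁σ_{m2}(x) σ_{m1}(x)/x₂ + ∂₂σ_{m2}(x) σ_{m2}(x)/x₂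
 − σ_{m2}(x)²/x₂²]`. -/
noncomputable def genLog2 (b2 s11 s12 s21 s22 : ℝ × ℝ → ℝ) (x : ℝ × ℝ) : ℝ :=
  b2 x / x.2 + (1 / 2) *
    ((pd1 s12 x * s11 x / x.2 + pd2 s12 x * s12 x / x.2 - s12 x ^ 2 / x.2 ^ 2)
      + (pd1 s22 x * s21 x / x.2 + pd2 s22 x * s22 x / x.2 - s22 x ^ 2 / x.2 ^ 2))

open Filter Topology

theorem tendsto_div_fst_of_hasStrictFDerivAt {f : ℝ × ℝ → ℝ} {f' : ℝ × ℝ →L[ℝ] ℝ}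
    (hf : HasStrictFDerivAt f f' (0, 0)) (h0 : ∀ y ∈ Ioo (0 : ℝ) 1, f (0, y) = 0) :
    Tendsto (fun x : ℝ × ℝ => f x / x.1) (𝓝[Ioi 0 ×ˢ Ioi 0] (0, 0)) (𝓝 (f' (1, 0))) := by
  have hproj : Tendsto (fun x : ℝ × ℝ => (x, ((0 : ℝ), x.2))) (𝓝[Ioi 0 ×ˢ Ioi 0] (0, 0))
      (𝓝 (((0 : ℝ), (0 : ℝ)), ((0 : ℝ), (0 : ℝ)))) := by
    have hc : Continuous (fun x : ℝ × ℝ => (x, ((0 : ℝ), x.2))) := by fun_prop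
    exact (hc.tendsto (0, 0)).mono_left nhdsWithin_le_nhds
  have hlt : ∀ᶠ x : ℝ × ℝ in 𝓝[Ioi 0 ×ˢ Ioi 0] (0, 0), x.2 < 1 :=
    nhdsWithin_le_nhds ((continuous_snd.tendsto ((0 : ℝ), (0 : ℝ))).eventually
      (gt_mem_nhds one_pos))
  rw [Metric.tendsto_nhds]
  intro ε hε
  filter_upwards [(hf.isLittleO.comp_tendsto hproj).def (half_pos hε), hlt,
    self_mem_nhdsWithin] with x hx hx2 hxs
  obtain ⟨h1 : 0 < x.1, h2 : 0 < x.2⟩ := hxs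
  have hdiff : x - (0, x.2) = x.1 • ((1 : ℝ), (0 : ℝ)) := by ext <;> simp
  simp only [Function.comp, h0 x.2 ⟨h2, hx2⟩, hdiff, map_smul, sub_zero, norm_smul,
    smul_eq_mul] at hx
  have hnorm : ‖((1 : ℝ), (0 : ℝ))‖ = 1 := by simp [Prod.norm_def]
  rw [hnorm, mul_one, Real.norm_eq_abs, Real.norm_eq_abs, abs_of_pos h1] at hx
  have hquot : f x / x.1 - f' (1, 0) = (f x - x.1 * f' (1, 0)) / x.1 := by field_simp
  rw [Real.dist_eq, hquot, abs_div, abs_of_pos h1, div_lt_iff₀ h1]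
  nlinarith

theorem pd2_eq_zero_of_vanish_left {f : ℝ × ℝ → ℝ}
    (h0 : ∀ y ∈ Ioo (0 : ℝ) 1, f (0, y) = 0) {y : ℝ} (hy : y ∈ Ioo (0 : ℝ) 1) :
    pd2 f (0, y) = 0 := by
  by_cases hd : DifferentiableAt ℝ f (0, y)
  · have hline : HasDerivAt (fun t : ℝ => ((0 : ℝ), t)) (0, 1) y :=
      (hasDerivAt_const y 0).prodMk (hasDerivAt_id y)
    have hzero : (fun t : ℝ => f (0, t)) =ᶠ[𝓝 y] fun _ => 0 := by
      filter_upwards [Ioo_mem_nhds hy.1 hy.2] with t ht using h0 t ht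
    exact (hd.hasFDerivAt.comp_hasDerivAt y hline).unique
      ((hasDerivAt_const y (0 : ℝ)).congr_of_eventuallyEq hzero)
  · simp [pd2, fderiv_zero_of_not_differentiableAt hd]

theorem contDiffAt_fderiv_apply {f : ℝ × ℝ → ℝ} {x : ℝ × ℝ} (hf : ContDiffAt ℝ 2 f x)
    (v : ℝ × ℝ) : ContDiffAt ℝ 1 (fun z => fderiv ℝ f z v) x :=
  (hf.fderiv_right (m := 1) (by norm_num)).clm_apply contDiffAt_const

theorem tendsto_div_fst {f : ℝ × ℝ → ℝ} (hf : ContDiffAt ℝ 1 f (0, 0))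
    (h0 : ∀ y ∈ Ioo (0 : ℝ) 1, f (0, y) = 0) :
    Tendsto (fun x : ℝ × ℝ => f x / x.1) (𝓝[Ioi 0 ×ˢ Ioi 0] (0, 0)) (𝓝 (pd1 f (0, 0))) :=
  tendsto_div_fst_of_hasStrictFDerivAt (hf.hasStrictFDerivAt one_ne_zero) h0

/-- The contribution of one noise field `(s, r)` to the generator of `ln ∘ x₁` vanishes at the
corner. -/
theorem tendsto_noise_term {s r : ℝ × ℝ → ℝ} (hs : ContDiffAt ℝ 2 s (0, 0))
    (hr : ContDiffAt ℝ 2 r (0, 0)) (hs0 : ∀ y ∈ Ioo (0 : ℝ) 1, s (0, y) = 0)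
    (hr0 : r (0, 0) = 0) :
    Tendsto (fun x : ℝ × ℝ =>
        pd2 s x * r x / x.1 + pd1 s x * s x / x.1 - s x ^ 2 / x.1 ^ 2)
      (𝓝[Ioi 0 ×ˢ Ioi 0] (0, 0)) (𝓝 0) := by
  have hquot := tendsto_div_fst (hs.of_le one_le_two) hs0
  have hpd2 := tendsto_div_fst (f := pd2 s) (contDiffAt_fderiv_apply hs (0, 1))
    fun y hy => pd2_eq_zero_of_vanish_left hs0 hy
  have hpd1 : Tendsto (pd1 s) (𝓝[Ioi 0 ×ˢ Ioi 0] (0, 0)) (𝓝 (pd1 s (0, 0))) :=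
    (contDiffAt_fderiv_apply hs (1, 0)).continuousAt.tendsto.mono_left nhdsWithin_le_nhds
  have hrlim : Tendsto r (𝓝[Ioi 0 ×ˢ Ioi 0] (0, 0)) (𝓝 0) := by
    have h := hr.continuousAt.tendsto
    rw [hr0] at h
    exact h.mono_left nhdsWithin_le_nhds
  convert ((hpd2.mul hrlim).add (hpd1.mul hquot)).sub (hquot.pow 2) using 2
  · ring
  · ring

theorem tendsto_genLog1 {b1 s11 s12 s21 s22 : ℝ × ℝ → ℝ}
    (hb1 : ContDiffAt ℝ 2 b1 (0, 0))
    (hs11 : ContDiffAt ℝ 2 s11 (0, 0)) (hs12 : ContDiffAt ℝ 2 s12 (0, 0))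
    (hs21 : ContDiffAt ℝ 2 s21 (0, 0)) (hs22 : ContDiffAt ℝ 2 s22 (0, 0))
    (h12 : s12 (0, 0) = 0) (h22 : s22 (0, 0) = 0)
    (hleft : ∀ y ∈ Ioo (0 : ℝ) 1, b1 (0, y) = 0 ∧ s11 (0, y) = 0 ∧ s21 (0, y) = 0) :
    Tendsto (genLog1 b1 s11 s12 s21 s22) (𝓝[Ioi 0 ×ˢ Ioi 0] (0, 0))
      (𝓝 (pd1 b1 (0, 0))) := by
  have hb := tendsto_div_fst (hb1.of_le one_le_two) fun y hy => (hleft y hy).1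
  have h1 := tendsto_noise_term hs11 hs12 (fun y hy => (hleft y hy).2.1) h12
  have h2 := tendsto_noise_term hs21 hs22 (fun y hy => (hleft y hy).2.2) h22
  have h := hb.add ((h1.add h2).const_mul (1 / 2))
  rwa [add_zero, mul_zero, add_zero] at h

theorem fderiv_comp_swap (f : ℝ × ℝ → ℝ) (x v : ℝ × ℝ) :
    fderiv ℝ (fun z : ℝ × ℝ => f z.swap) x v = fderiv ℝ f x.swap v.swap :=
  DFunLike.congr_fun
    ((ContinuousLinearEquiv.prodComm ℝ ℝ ℝ).comp_right_fderiv (f := f) (x := x)) v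

theorem pd1_comp_swap (f : ℝ × ℝ → ℝ) (x : ℝ × ℝ) :
    pd1 (fun z : ℝ × ℝ => f z.swap) x = pd2 f x.swap :=
  fderiv_comp_swap f x (1, 0)

theorem pd2_comp_swap (f : ℝ × ℝ → ℝ) (x : ℝ × ℝ) :
    pd2 (fun z : ℝ × ℝ => f z.swap) x = pd1 f x.swap :=
  fderiv_comp_swap f x (0, 1)

theorem genLog1_comp_swap (b2 s11 s12 s21 s22 : ℝ × ℝ → ℝ) (x : ℝ × ℝ) :
    genLog1 (fun z => b2 z.swap) (fun z => s12 z.swap) (fun z => s11 z.swap)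
      (fun z => s22 z.swap) (fun z => s21 z.swap) x.swap = genLog2 b2 s11 s12 s21 s22 x := by
  simp [genLog1, genLog2, pd1_comp_swap, pd2_comp_swap]

theorem exists_delta_of_tendsto_corner {g : ℝ × ℝ → ℝ} {l : ℝ}
    (hg : Tendsto g (𝓝[Ioi 0 ×ˢ Ioi 0] (0, 0)) (𝓝 l)) {ε : ℝ} (hε : 0 < ε) :
    ∃ δ > (0 : ℝ), ∀ x : ℝ × ℝ, 0 < x.1 → 0 < x.2 → x.1 + x.2 < δ → |g x - l| < ε := by
  obtain ⟨δ, hδ, h⟩ := Metric.tendsto_nhdsWithin_nhds.1 hg ε hε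
  refine ⟨δ, hδ, fun x h1 h2 hx => h ⟨h1, h2⟩ ?_⟩
  rw [Prod.dist_eq, max_lt_iff, Real.dist_eq, Real.dist_eq, sub_zero, sub_zero,
    abs_of_pos h1, abs_of_pos h2]
  constructor <;> linarith

/-- Lemma 4.1 of the paper: under the smoothness and boundary-invariance assumptions,
the generator applied to `ln ∘ x_i` converges to `λ_i = ∂_i b_i(0,0)` as `x → (0,0)`
in the open unit square. -/
theorem generator_log_near_corner
    (U : Set (ℝ × ℝ)) (hU : IsOpen U)
    (hsq : Set.Icc ((0 : ℝ), (0 : ℝ)) (1, 1) ⊆ U)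
    (b1 b2 s11 s12 s21 s22 : ℝ × ℝ → ℝ)
    (hb1 : ContDiffOn ℝ 2 b1 U) (hb2 : ContDiffOn ℝ 2 b2 U)
    (hs11 : ContDiffOn ℝ 2 s11 U) (hs12 : ContDiffOn ℝ 2 s12 U)
    (hs21 : ContDiffOn ℝ 2 s21 U) (hs22 : ContDiffOn ℝ 2 s22 U)
    (hbot : ∀ x₁ ∈ Set.Icc (0 : ℝ) 1,
      b2 (x₁, 0) = 0 ∧ s12 (x₁, 0) = 0 ∧ s22 (x₁, 0) = 0)
    (hleft : ∀ x₂ ∈ Set.Icc (0 : ℝ) 1,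
      b1 (0, x₂) = 0 ∧ s11 (0, x₂) = 0 ∧ s21 (0, x₂) = 0) :
    ∀ ε > (0 : ℝ), ∃ δ > (0 : ℝ), ∀ x : ℝ × ℝ,
      x.1 ∈ Set.Ioo (0 : ℝ) 1 → x.2 ∈ Set.Ioo (0 : ℝ) 1 → x.1 + x.2 < δ →
      |genLog1 b1 s11 s12 s21 s22 x - pd1 b1 (0, 0)| < ε ∧
      |genLog2 b2 s11 s12 s21 s22 x - pd2 b2 (0, 0)| < ε := by
  intro ε hε
  have hmem : U ∈ 𝓝 ((0 : ℝ), (0 : ℝ)) := hU.mem_nhds (hsq ⟨le_rfl, by simp⟩)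
  have hz : (0 : ℝ) ∈ Icc (0 : ℝ) 1 := ⟨le_rfl, zero_le_one⟩
  have hswap {f : ℝ × ℝ → ℝ} (hf : ContDiffOn ℝ 2 f U) :
      ContDiffAt ℝ 2 (fun z : ℝ × ℝ => f z.swap) (0, 0) :=
    (hf.contDiffAt hmem).comp ((0 : ℝ), (0 : ℝ)) (contDiff_snd.prodMk contDiff_fst).contDiffAt
  have hlim1 := tendsto_genLog1 (hb1.contDiffAt hmem) (hs11.contDiffAt hmem)
    (hs12.contDiffAt hmem) (hs21.contDiffAt hmem) (hs22.contDiffAt hmem)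
    (hbot 0 hz).2.1 (hbot 0 hz).2.2 fun y hy => hleft y (Ioo_subset_Icc_self hy)
  have hlim2 := tendsto_genLog1 (hswap hb2) (hswap hs12) (hswap hs11) (hswap hs22) (hswap hs21)
    (hleft 0 hz).2.1 (hleft 0 hz).2.2 fun y hy => hbot y (Ioo_subset_Icc_self hy)
  obtain ⟨δ₁, hδ₁, h1⟩ := exists_delta_of_tendsto_corner hlim1 hε
  obtain ⟨δ₂, hδ₂, h2⟩ := exists_delta_of_tendsto_corner hlim2 hε
  refine ⟨min δ₁ δ₂, lt_min hδ₁ hδ₂, fun x hx1 hx2 hx => ?_⟩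
  obtain ⟨hlt1, hlt2⟩ := lt_min_iff.1 hx
  refine ⟨h1 x hx1.1 hx2.1 hlt1, ?_⟩
  have h := h2 x.swap hx2.1 hx1.1 (by simpa [add_comm] using hlt2)
  rwa [genLog1_comp_swap, pd1_comp_swap] at h
end

section
/- Let ρ₀, ρ₁, ρ₂, ρ₃ and λ₀, λ₁, λ₂, λ₃ be positive real numbers, with indices in ℤ/4ℤ. For k, j ∈ ℤ/4ℤ define f_{k,j} = (∏_{i=0}^{n(k,j)} ρ_{k+1+i}) / λ_j, where n(k,j) ∈ {0,1,2,3} is the representative of j − (k+1) modulo 4 (so that the product runs over the cyclic run of indices from k+1 = k−3 up to j). For k ∈ ℤ/4ℤ define the probability vector μ̄_k on ℤ/4ℤ by μ̄_k(j) = f_{k,j} / Σ_{j′ ∈ ℤ/4ℤ} f_{k,j′}. If Π = ρ₀ρ₁ρ₂ρ₃ > 1, then μ̄_k ≠ μ̄_{k+1} for every k ∈ ℤ/4ℤ; equivalently, the vectors (f_{k,j})_{j ∈ ℤ/4ℤ} and (f_{k+1,j})_{j ∈ ℤ/4ℤ} are not proportional. -/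
/-- `f_{k,j} = (∏_{i=0}^{n(k,j)} ρ_{k+1+i}) / λ_j`, where `n(k,j) ∈ {0,1,2,3}` is the
representative of `j - (k+1)` modulo 4, so the product runs over the cyclic run of
indices from `k+1` up to `j`. -/
noncomputable def cycleWeight (ρ lam : ZMod 4 → ℝ) (k j : ZMod 4) : ℝ :=
  (∏ i ∈ Finset.range ((j - (k + 1)).val + 1), ρ (k + 1 + (i : ZMod 4))) / lam j

/-- The probability vector `μ̄_k` on `ℤ/4ℤ` with `μ̄_k(j) = f_{k,j} / Σ_{j'} f_{k,j'}`. -/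
noncomputable def cycleMixture (ρ lam : ZMod 4 → ℝ) (k : ZMod 4) : ZMod 4 → ℝ :=
  fun j => cycleWeight ρ lam k j / ∑ j' : ZMod 4, cycleWeight ρ lam k j'

theorem cycleWeight_pos {ρ lam : ZMod 4 → ℝ} (hρ : ∀ k, 0 < ρ k) (hlam : ∀ k, 0 < lam k)
    (k j : ZMod 4) : 0 < cycleWeight ρ lam k j :=
  div_pos (Finset.prod_pos fun _ _ => hρ _) (hlam j)

theorem sum_cycleWeight_pos {ρ lam : ZMod 4 → ℝ} (hρ : ∀ k, 0 < ρ k) (hlam : ∀ k, 0 < lam k)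
    (k : ZMod 4) : 0 < ∑ j, cycleWeight ρ lam k j :=
  Finset.sum_pos (fun _ _ => cycleWeight_pos hρ hlam _ _) Finset.univ_nonempty

theorem mul_cycleWeight_succ_of_ne (ρ lam : ZMod 4 → ℝ) {k j : ZMod 4} (h : j ≠ k + 1) :
    ρ (k + 1) * cycleWeight ρ lam (k + 1) j = cycleWeight ρ lam k j := by
  have hval : ∀ d : ZMod 4, d ≠ 0 → d.val = (d - 1).val + 1 := by decide
  have hkj : (j - (k + 1)).val = (j - (k + 1 + 1)).val + 1 := by
    rw [hval _ (sub_ne_zero.mpr h), sub_sub]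
  unfold cycleWeight
  rw [hkj, Finset.prod_range_succ' _ ((j - (k + 1 + 1)).val + 1), ← mul_div_assoc,
    mul_comm (ρ (k + 1))]
  simp only [Nat.cast_add, Nat.cast_one, Nat.cast_zero, add_zero, add_assoc, add_comm (1 : ZMod 4)]

theorem mul_cycleWeight_succ_self (ρ lam : ZMod 4 → ℝ) (k : ZMod 4) :
    ρ (k + 1) * cycleWeight ρ lam (k + 1) (k + 1) =
      (ρ 0 * ρ 1 * ρ 2 * ρ 3) * cycleWeight ρ lam k (k + 1) := by
  have hprod : ∏ i ∈ Finset.range 4, ρ (k + 1 + 1 + (i : ZMod 4)) = ρ 0 * ρ 1 * ρ 2 * ρ 3 := by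
    have hshift : ∏ i : ZMod 4, ρ (k + 1 + 1 + i) = ∏ i : ZMod 4, ρ i :=
      Equiv.prod_comp (Equiv.addLeft (k + 1 + 1)) ρ
    have huniv (g : ZMod 4 → ℝ) : ∏ i, g i = g 0 * g 1 * g 2 * g 3 := Fin.prod_univ_four g
    rw [← huniv, ← hshift, huniv]
    simp [Finset.prod_range_succ]
  have hval : (k + 1 - (k + 1 + 1)).val = 3 := by
    rw [sub_add_cancel_left]
    decide
  unfold cycleWeight
  rw [hval, hprod, sub_self]
  simp
  ring

/-- Corollary 5.10 of the paper: if the stability index `Π = ρ₀ρ₁ρ₂ρ₃` exceeds 1, then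
the consecutive limit measures `μ̄_k` and `μ̄_{k+1}` are distinct for every `k`;
equivalently, the weight vectors `(f_{k,j})_j` and `(f_{k+1,j})_j` are not proportional. -/
theorem cycleMixture_ne_succ (ρ lam : ZMod 4 → ℝ) (hρ : ∀ k, 0 < ρ k)
    (hlam : ∀ k, 0 < lam k) (hPi : 1 < ρ 0 * ρ 1 * ρ 2 * ρ 3) :
    ∀ k : ZMod 4, cycleMixture ρ lam k ≠ cycleMixture ρ lam (k + 1) := by
  intro k h
  have hS := sum_cycleWeight_pos hρ hlam k
  have hS' := sum_cycleWeight_pos hρ hlam (k + 1)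
  have hcross (j : ZMod 4) := (div_eq_div_iff hS.ne' hS'.ne').mp (congrFun h j)
  have hne : k + 1 + 1 ≠ k + 1 := add_ne_left.mpr (by decide)
  have hsum : ∑ j, cycleWeight ρ lam k j = ρ (k + 1) * ∑ j, cycleWeight ρ lam (k + 1) j := by
    apply mul_left_cancel₀ (cycleWeight_pos hρ hlam (k + 1) (k + 1 + 1)).ne'
    rw [← hcross, ← mul_cycleWeight_succ_of_ne ρ lam hne]
    ring
  have hself := hcross (k + 1)
  rw [hsum, ← mul_assoc, mul_comm _ (ρ (k + 1)), mul_cycleWeight_succ_self] at hself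
  have hone := mul_right_cancel₀ hS'.ne' hself
  exact (lt_mul_of_one_lt_left (cycleWeight_pos hρ hlam k (k + 1)) hPi).ne hone
end

section
/- Let 𝕏 be a compact metric space, and let (P^t)_{t ≥ 0} be a semigroup of Markov probability kernels on 𝕏 (P^0 is the identity kernel and P^{t+s} = P^t ∘ P^s for all s, t ≥ 0) with the Feller property: for every bounded continuous f : 𝕏 → ℝ and every t ≥ 0, the map x ↦ ∫ f(y) P^t(x, dy) is continuous. Let (X_t)_{t ≥ 0} be a stochastic process on a probability space (Ω, 𝓕, P) with almost surely continuous paths, adapted to a filtration (𝓕_t)_{t ≥ 0}, satisfying the Markov property: for every bounded measurable f : 𝕏 → ℝ and all s, t ≥ 0, E[ f(X_{t+s}) | 𝓕_t ] = ∫ f(y) P^s(X_t, dy) almost surely. For t > 0 define the empirical (occupation) probability measure ε_t on 𝕏 by ε_t(A) = (1/t)·λ({s ∈ [0,t] : X_s ∈ A}) for Borel A ⊆ 𝕏, where λ is Lebesgue measure. Then, with probability 1, every weak limit point of (ε_t)_{t > 0} as t → ∞ (in the topology of weak convergence of probability measures on 𝕏) is invariant under the semigroup, i.e., is a probability measure μ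 satisfying ∫ P^t(x, A) μ(dx) = μ(A) for every t ≥ 0 and every Borel A ⊆ 𝕏. -/
open MeasureTheory ProbabilityTheory Filter Set
open scoped ENNReal

/-- The empirical (occupation) measure of a path `X : ℝ → 𝕏` at time `t > 0`:
`ε_t(A) = (1/t) · λ {s ∈ [0,t] : X s ∈ A}`. -/
noncomputable def pathEmpiricalMeasure {𝕏 : Type*} [MeasurableSpace 𝕏]
    (X : ℝ → 𝕏) (t : ℝ) : Measure 𝕏 :=
  (ENNReal.ofReal t)⁻¹ • Measure.map X (volume.restrict (Set.Icc (0 : ℝ) t))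

lemma integral_measure_comp {α β : Type*} [MeasurableSpace α] [MeasurableSpace β]
    {κ : Kernel α β} {ν : Measure α} [SFinite ν] [IsSFiniteKernel κ] {f : β → ℝ}
    (hf : Integrable f (κ ∘ₘ ν)) : ∫ y, f y ∂(κ ∘ₘ ν) = ∫ x, ∫ y, f y ∂(κ x) ∂ν := by
  have h := Kernel.integral_comp (η := κ) (κ := Kernel.const Unit ν) (a := ()) (f := f)
  rw [Kernel.comp_apply, Kernel.const_apply] at h
  exact h hf

/-- A measurable function on `[0, ∞)` that is invariant under rational shifts takes the same value
at some point and at its translate by any given `h ≥ 0`. -/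
lemma exists_eq_add_of_rational_shift_invariant {β : Type*} [MeasurableSpace β] [Nonempty β]
    [MeasurableSpace.CountablySeparated β] {u : ℝ → β} (hu : Measurable u)
    (hshift : ∀ a b : ℝ, 0 ≤ a → 0 ≤ b → (∃ q : ℚ, a - b = q) → u a = u b)
    {h : ℝ} (hh : 0 ≤ h) : ∃ t, 0 ≤ t ∧ u (t + h) = u t := by
  let r : UnitAddCircle → ℝ := fun θ => AddCircle.equivIco 1 0 θ
  have hr : Measurable r :=
    measurable_subtype_coe.comp (AddCircle.measurableEquivIco 1 0).measurable
  have hr0 : ∀ θ, 0 ≤ r θ := fun θ => (AddCircle.equivIco 1 0 θ).2.1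
  have hrcoe : ∀ θ, (r θ : UnitAddCircle) = θ := fun θ => AddCircle.coe_equivIco
  have hdiff : ∀ (θ : UnitAddCircle) (x : ℝ),
      ∃ n : ℤ, r ((x : UnitAddCircle) + θ) - (x + r θ) = n := by
    intro θ x
    have h1 : ((r ((x : UnitAddCircle) + θ) - (x + r θ) : ℝ) : UnitAddCircle) = 0 := by
      rw [AddCircle.coe_sub, AddCircle.coe_add, hrcoe, hrcoe, sub_self]
    obtain ⟨n, hn⟩ := (AddCircle.coe_eq_zero_iff (1 : ℝ)).1 h1
    exact ⟨n, by rw [← hn]; simp⟩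
  obtain ⟨c, hc⟩ : ∃ c, (u ∘ r) =ᵐ[volume] Function.const UnitAddCircle c := by
    refine Filter.exists_eventuallyEq_const_of_forall_separating MeasurableSet fun U hU => ?_
    have hconst : EventuallyConst ((u ∘ r) ⁻¹' U) (ae (volume : Measure UnitAddCircle)) := by
      refine aeconst_of_dense_setOfPred_preimage_vadd_eq (M := UnitAddCircle)
        ((hu.comp hr) hU).nullMeasurableSet ?_
      have hd : DenseRange (fun q : ℚ => ((q : ℝ) : UnitAddCircle)) :=
        (QuotientAddGroup.mk_surjective.denseRange).comp Rat.denseRange_cast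
          (AddCircle.continuous_mk' 1)
      refine hd.mono ?_
      rintro _ ⟨q, rfl⟩
      ext θ
      obtain ⟨n, hn⟩ := hdiff θ q
      have : u (r (((q : ℝ) : UnitAddCircle) + θ)) = u (r θ) :=
        hshift _ _ (hr0 _) (hr0 _) ⟨n + q, by push_cast; linarith⟩
      simp [this]
    exact eventuallyConst_set.1 hconst
  have hc' : ∀ᵐ θ : UnitAddCircle, u (r ((h : UnitAddCircle) + θ)) = c :=
    (measurePreserving_add_left volume (h : UnitAddCircle)).quasiMeasurePreserving.ae
      (p := fun θ => u (r θ) = c) hc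
  obtain ⟨θ, h1, h2⟩ := (hc.and hc').exists
  refine ⟨r θ, hr0 θ, ?_⟩
  obtain ⟨n, hn⟩ := hdiff θ h
  have h3 : u (r ((h : UnitAddCircle) + θ)) = u (r θ + h) :=
    hshift _ _ (hr0 _) (add_nonneg (hr0 _) hh) ⟨n, by push_cast; linarith⟩
  rw [← h3, h2]
  exact h1.symm

lemma abs_integral_le_norm_of_isProbabilityMeasure {𝕏 : Type*} [TopologicalSpace 𝕏]
    [CompactSpace 𝕏] [MeasurableSpace 𝕏] (g : C(𝕏, ℝ)) (ν : Measure 𝕏) [IsProbabilityMeasure ν] :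
    |∫ x, g x ∂ν| ≤ ‖g‖ := by
  simpa using norm_integral_le_of_norm_le_const (μ := ν) (ae_of_all _ g.norm_coe_le_norm)

lemma ContinuousMap.integrable_of_isFiniteMeasure {𝕏 : Type*} [TopologicalSpace 𝕏]
    [CompactSpace 𝕏] [MeasurableSpace 𝕏] [OpensMeasurableSpace 𝕏] (g : C(𝕏, ℝ)) (ν : Measure 𝕏)
    [IsFiniteMeasure ν] : Integrable g ν :=
  (BoundedContinuousFunction.mkOfCompact g).integrable ν

lemma continuous_integral_continuousMap {𝕏 : Type*} [TopologicalSpace 𝕏]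
    [CompactSpace 𝕏] [MeasurableSpace 𝕏] [OpensMeasurableSpace 𝕏] (ν : Measure 𝕏)
    [IsProbabilityMeasure ν] : Continuous fun g : C(𝕏, ℝ) => ∫ x, g x ∂ν := by
  refine (LipschitzWith.of_dist_le_mul (K := 1) fun f g => ?_).continuous
  rw [Real.dist_eq, ← integral_sub (f.integrable_of_isFiniteMeasure ν)
    (g.integrable_of_isFiniteMeasure ν), NNReal.coe_one, one_mul, dist_eq_norm]
  exact abs_integral_le_norm_of_isProbabilityMeasure (f - g) ν

/-- Probability measures on a compact metric space are determined by the integrals of a dense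
sequence of continuous functions. -/
lemma ext_of_integral_denseSeq_eq {𝕏 : Type*} [MetricSpace 𝕏] [CompactSpace 𝕏]
    [MeasurableSpace 𝕏] [BorelSpace 𝕏] {ν ν' : Measure 𝕏} [IsProbabilityMeasure ν]
    [IsProbabilityMeasure ν']
    (h : ∀ n, ∫ x, TopologicalSpace.denseSeq C(𝕏, ℝ) n x ∂ν =
      ∫ x, TopologicalSpace.denseSeq C(𝕏, ℝ) n x ∂ν') : ν = ν' := by
  have key := (TopologicalSpace.denseRange_denseSeq C(𝕏, ℝ)).equalizer
    (continuous_integral_continuousMap ν) (continuous_integral_continuousMap ν') (funext h)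
  exact ext_of_forall_integral_eq_of_IsFiniteMeasure fun f => congrFun key f.toContinuousMap

/-- A probability measure invariant under a Markov semigroup at rational times, and along which the
semigroup is measurable in time, is invariant at all times. -/
lemma comp_eq_of_rational_invariant {𝕏 : Type*} [MetricSpace 𝕏] [CompactSpace 𝕏]
    [MeasurableSpace 𝕏] [BorelSpace 𝕏] (P : ℝ → Kernel 𝕏 𝕏) [∀ t, IsMarkovKernel (P t)]
    (hsemigroup : ∀ s t : ℝ, 0 ≤ s → 0 ≤ t → P (t + s) = (P t) ∘ₖ (P s))
    (ν : Measure 𝕏) [IsProbabilityMeasure ν]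
    (hrat : ∀ q : ℚ, 0 ≤ q → P q ∘ₘ ν = ν)
    (hmeas : ∀ g : C(𝕏, ℝ), Measurable fun t : ℝ => ∫ x, g x ∂(P (max t 0) ∘ₘ ν))
    {t : ℝ} (ht : 0 ≤ t) : P t ∘ₘ ν = ν := by
  have hadd : ∀ a b : ℝ, 0 ≤ a → 0 ≤ b → P (a + b) ∘ₘ ν = P a ∘ₘ (P b ∘ₘ ν) := by
    intro a b ha hb
    rw [Measure.comp_assoc, hsemigroup b a hb ha]
  have hle : ∀ a b : ℝ, 0 ≤ b → b ≤ a → (∃ q : ℚ, a - b = q) → P a ∘ₘ ν = P b ∘ₘ ν := by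
    rintro a b hb hba ⟨q, hq⟩
    have hq0 : (0 : ℝ) ≤ q := by rw [← hq]; linarith
    rw [show a = b + q by linarith, hadd b q hb hq0, hrat q (by exact_mod_cast hq0)]
  have hshift : ∀ a b : ℝ, 0 ≤ a → 0 ≤ b → (∃ q : ℚ, a - b = q) → P a ∘ₘ ν = P b ∘ₘ ν := by
    rintro a b ha hb ⟨q, hq⟩
    rcases le_total b a with hba | hba
    · exact hle a b hb hba ⟨q, hq⟩
    · exact (hle b a ha hba ⟨-q, by push_cast; linarith⟩).symm
  let u : ℝ → ℕ → ℝ := fun t n =>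
    ∫ x, TopologicalSpace.denseSeq C(𝕏, ℝ) n x ∂(P (max t 0) ∘ₘ ν)
  obtain ⟨s, hs, hst⟩ := exists_eq_add_of_rational_shift_invariant (u := u)
    (measurable_pi_lambda _ fun n => hmeas _)
    (fun a b ha hb hab => by simp only [u, max_eq_left ha, max_eq_left hb, hshift a b ha hb hab]) ht
  have hst' : P (s + t) ∘ₘ ν = P s ∘ₘ ν := ext_of_integral_denseSeq_eq fun n => by
    simpa only [u, max_eq_left hs, max_eq_left (add_nonneg hs ht)] using congrFun hst n
  obtain ⟨N, hN⟩ := exists_nat_ge s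
  have hNν : P N ∘ₘ ν = ν := by simpa using hrat N (by positivity)
  have h1 : P ((N - s) + (s + t)) ∘ₘ ν = ν := by
    rw [hadd _ _ (by linarith) (by positivity), hst', ← hadd _ _ (by linarith) hs, sub_add_cancel,
      hNν]
  rwa [show (N - s) + (s + t) = t + N by ring, hadd _ _ ht (by positivity), hNν] at h1

lemma abs_integral_le_of_abs_le {α : Type*} [MeasurableSpace α] {μ : Measure α} [IsFiniteMeasure μ]
    {f : α → ℝ} {C : ℝ} (hC : ∀ x, |f x| ≤ C) : |∫ x, f x ∂μ| ≤ C * μ.real univ :=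
  norm_integral_le_of_norm_le_const (f := f) (ae_of_all _ hC)

lemma abs_intervalIntegral_le_of_abs_le {f : ℝ → ℝ} {C : ℝ} (hC : ∀ s, |f s| ≤ C) (a b : ℝ) :
    |∫ s in a..b, f s| ≤ C * |b - a| :=
  intervalIntegral.norm_integral_le_of_norm_le_const (f := f) fun s _ => hC s

lemma intervalIntegrable_of_abs_le {f : ℝ → ℝ} (hf : Measurable f) {C : ℝ} (hC : ∀ s, |f s| ≤ C)
    (a b : ℝ) : IntervalIntegrable f volume a b :=
  (intervalIntegrable_const (c := C)).mono_fun hf.aestronglyMeasurable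
    (ae_of_all _ fun s => (hC s).trans (le_abs_self C))

/-- The time averages of a bounded function converge to zero as soon as they do along squares. -/
lemma tendsto_average_zero_of_tendsto_sq {f : ℝ → ℝ} (hf : Measurable f) {C : ℝ}
    (hC : ∀ s, |f s| ≤ C)
    (hsq : Tendsto (fun n : ℕ => ((n : ℝ) ^ 2)⁻¹ * ∫ s in (0 : ℝ)..(n : ℝ) ^ 2, f s) atTop (nhds 0)) :
    Tendsto (fun T : ℝ => T⁻¹ * ∫ s in (0 : ℝ)..T, f s) atTop (nhds 0) := by
  have hC0 : 0 ≤ C := (abs_nonneg _).trans (hC 0)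
  let b : ℕ → ℝ := fun n =>
    |((n : ℝ) ^ 2)⁻¹ * ∫ s in (0 : ℝ)..(n : ℝ) ^ 2, f s| + 3 * C * (n : ℝ)⁻¹
  have hb : Tendsto b atTop (nhds 0) := by
    simpa [b, abs_mul] using hsq.abs.add (tendsto_inv_atTop_nhds_zero_nat.const_mul (3 * C))
  have hfloor : Tendsto (fun T : ℝ => ⌊√T⌋₊) atTop atTop :=
    tendsto_nat_floor_atTop.comp Real.tendsto_sqrt_atTop
  refine squeeze_zero_norm' ?_ (hb.comp hfloor)
  filter_upwards [eventually_ge_atTop 1] with T hT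
  have hT0 : 0 ≤ T := zero_le_one.trans hT
  simp only [Function.comp_apply, b]
  set n := ⌊√T⌋₊ with hn
  have hn1 : (1 : ℝ) ≤ n := by
    exact_mod_cast Nat.le_floor (by simpa using Real.one_le_sqrt.2 hT)
  have hle : (n : ℝ) ^ 2 ≤ T := by
    calc (n : ℝ) ^ 2 ≤ √T ^ 2 := by gcongr; exact Nat.floor_le (Real.sqrt_nonneg T)
      _ = T := Real.sq_sqrt hT0
  have hlt : T ≤ ((n : ℝ) + 1) ^ 2 := by
    calc T = √T ^ 2 := (Real.sq_sqrt hT0).symm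
      _ ≤ ((n : ℝ) + 1) ^ 2 := by gcongr; exact (Nat.lt_floor_add_one _).le
  have hsplit : ∫ s in (0 : ℝ)..T, f s =
      (∫ s in (0 : ℝ)..(n : ℝ) ^ 2, f s) + ∫ s in (n : ℝ) ^ 2..T, f s :=
    (intervalIntegral.integral_add_adjacent_intervals (intervalIntegrable_of_abs_le hf hC _ _)
      (intervalIntegrable_of_abs_le hf hC _ _)).symm
  have hrest : |∫ s in (n : ℝ) ^ 2..T, f s| ≤ 3 * C * n := by
    calc |∫ s in (n : ℝ) ^ 2..T, f s| ≤ C * |T - (n : ℝ) ^ 2| :=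
          abs_intervalIntegral_le_of_abs_le hC _ _
      _ ≤ C * (3 * n) := by
          rw [abs_of_nonneg (by linarith)]
          gcongr
          nlinarith
      _ = 3 * C * n := by ring
  have hn2 : (0 : ℝ) < (n : ℝ) ^ 2 := by positivity
  calc ‖T⁻¹ * ∫ s in (0 : ℝ)..T, f s‖
      = T⁻¹ * |(∫ s in (0 : ℝ)..(n : ℝ) ^ 2, f s) + ∫ s in (n : ℝ) ^ 2..T, f s| := by
        rw [hsplit, Real.norm_eq_abs, abs_mul, abs_of_nonneg (inv_nonneg.2 hT0)]
    _ ≤ ((n : ℝ) ^ 2)⁻¹ * (|∫ s in (0 : ℝ)..(n : ℝ) ^ 2, f s| + 3 * C * n) := by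
        gcongr
        exact (abs_add_le _ _).trans (by gcongr)
    _ = _ := by
        rw [abs_mul, abs_of_nonneg (inv_nonneg.2 hn2.le)]
        field_simp

/-- Second moment bound for the time integral of a bounded process whose values at times more than
`t` apart are uncorrelated. -/
lemma integral_sq_intervalIntegral_le {Ω : Type*} [MeasurableSpace Ω] {μ : Measure Ω}
    [IsProbabilityMeasure μ] {D : ℝ → Ω → ℝ} (hD : Measurable (Function.uncurry D)) {C : ℝ}
    (hC : ∀ s ω, |D s ω| ≤ C) {t : ℝ} (ht : 0 ≤ t)
    (horth : ∀ r s : ℝ, 0 ≤ r → r + t ≤ s → ∫ ω, D r ω * D s ω ∂μ = 0) {T : ℝ} (hT : 0 ≤ T) :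
    ∫ ω, (∫ s in (0 : ℝ)..T, D s ω) ^ 2 ∂μ ≤ 2 * t * C ^ 2 * T := by
  have hΩ : Nonempty Ω := nonempty_of_isProbabilityMeasure μ
  have hC0 : 0 ≤ C := (abs_nonneg _).trans (hC 0 hΩ.some)
  have hmul : ∀ r s ω, |D r ω * D s ω| ≤ C ^ 2 := fun r s ω => by
    rw [abs_mul, sq]
    exact mul_le_mul (hC r ω) (hC s ω) (abs_nonneg _) hC0
  let I : Measure ℝ := volume.restrict (Ioc 0 T)
  let Z : Ω → ℝ := fun ω => ∫ s, D s ω ∂I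
  have hZmeas : Measurable Z :=
    hD.stronglyMeasurable.integral_prod_left'.measurable
  have hZbound : ∀ ω, |Z ω| ≤ C * T := fun ω => by
    simpa [I, hT, measureReal_def] using abs_integral_le_of_abs_le (μ := I)
      fun s => hC s ω
  have hswap₁ : ∫ ω, ∫ s, D s ω * Z ω ∂I ∂μ = ∫ s, ∫ ω, D s ω * Z ω ∂μ ∂I := by
    refine integral_integral_swap (Integrable.of_bound ?_ (C * (C * T)) (ae_of_all _ fun p => ?_))
    · exact ((hD.comp measurable_swap).mul (hZmeas.comp measurable_fst)).aestronglyMeasurable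
    · simp only [Function.uncurry, Real.norm_eq_abs, abs_mul]
      exact mul_le_mul (hC _ _) (hZbound _) (abs_nonneg _) hC0
  have hswap₂ : ∀ s, ∫ ω, D s ω * Z ω ∂μ = ∫ r, ∫ ω, D s ω * D r ω ∂μ ∂I := by
    intro s
    simp only [Z, ← integral_const_mul]
    refine integral_integral_swap (Integrable.of_bound ?_ (C ^ 2) (ae_of_all _ fun p => hmul _ _ _))
    exact ((hD.comp (measurable_const.prodMk measurable_fst)).mul
      (hD.comp measurable_swap)).aestronglyMeasurable
  have hcorr : ∀ s r : ℝ, 0 < s → 0 < r →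
      ∫ ω, D s ω * D r ω ∂μ ≤ (Icc (s - t) (s + t)).indicator (fun _ => C ^ 2) r := by
    intro s r hs hr
    by_cases hmem : r ∈ Icc (s - t) (s + t)
    · rw [indicator_of_mem hmem]
      have := abs_integral_le_of_abs_le (μ := μ) fun ω => hmul s r ω
      simp only [probReal_univ, mul_one] at this
      exact (le_abs_self _).trans this
    · rw [indicator_of_notMem hmem]
      rw [mem_Icc, not_and_or, not_le, not_le] at hmem
      rcases hmem with hlt | hlt
      · simp_rw [mul_comm (D s _)]
        exact (horth r s hr.le (by linarith)).le
      · exact (horth s r hs.le hlt.le).le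
  have hind : ∀ s, Integrable ((Icc (s - t) (s + t)).indicator fun _ => C ^ 2) := fun s =>
    (integrable_indicator_iff measurableSet_Icc).2 (by simp)
  have hinner : ∀ s ∈ Ioc 0 T, ∫ r, ∫ ω, D s ω * D r ω ∂μ ∂I ≤ 2 * t * C ^ 2 := by
    intro s hs
    calc ∫ r, ∫ ω, D s ω * D r ω ∂μ ∂I
        ≤ ∫ r in Ioc 0 T, (Icc (s - t) (s + t)).indicator (fun _ => C ^ 2) r := by
          refine setIntegral_mono_on ?_ (hind s).integrableOn measurableSet_Ioc
            fun r hr => hcorr s r hs.1 hr.1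
          refine Integrable.of_bound ?_ (C ^ 2) (ae_of_all _ fun r => ?_)
          · exact ((hD.comp (measurable_const.prodMk measurable_snd)).mul
              hD).stronglyMeasurable.integral_prod_right'.aestronglyMeasurable
          · simpa using abs_integral_le_of_abs_le (μ := μ) fun ω => hmul s r ω
      _ ≤ ∫ r, (Icc (s - t) (s + t)).indicator (fun _ => C ^ 2) r :=
          setIntegral_le_integral (hind s)
            (ae_of_all _ fun r => indicator_nonneg (fun _ _ => sq_nonneg C) r)
      _ = 2 * t * C ^ 2 := by
          rw [integral_indicator measurableSet_Icc, setIntegral_const, Real.volume_real_Icc_of_le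
            (by linarith), smul_eq_mul]
          ring
  calc ∫ ω, (∫ s in (0 : ℝ)..T, D s ω) ^ 2 ∂μ = ∫ ω, ∫ s, D s ω * Z ω ∂I ∂μ := by
        refine integral_congr_ae (ae_of_all _ fun ω => ?_)
        simp only [intervalIntegral.integral_of_le hT, integral_mul_const, sq, Z, I]
    _ = ∫ s in Ioc 0 T, ∫ r, ∫ ω, D s ω * D r ω ∂μ ∂I := by
        rw [hswap₁]
        simp only [hswap₂, I]
    _ ≤ ∫ s in Ioc 0 T, 2 * t * C ^ 2 := by
        refine setIntegral_mono_on ?_ (integrable_const _) measurableSet_Ioc hinner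
        refine Integrable.congr (f := fun s => ∫ ω, D s ω * Z ω ∂μ) ?_ (ae_of_all _ hswap₂)
        refine Integrable.of_bound ?_ (C * (C * T)) (ae_of_all _ fun s => ?_)
        · exact (hD.mul (hZmeas.comp
            measurable_snd)).stronglyMeasurable.integral_prod_right'.aestronglyMeasurable
        · simpa using abs_integral_le_of_abs_le (μ := μ) (f := fun ω => D s ω * Z ω)
            (C := C * (C * T)) fun ω => by
              rw [abs_mul]
              exact mul_le_mul (hC _ _) (hZbound _) (abs_nonneg _) hC0
    _ = 2 * t * C ^ 2 * T := by
        rw [setIntegral_const, Real.volume_real_Ioc_of_le hT, smul_eq_mul]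
        ring

/-- Law of large numbers for a bounded process whose values at times more than `t` apart are
uncorrelated. -/
lemma ae_tendsto_average_zero {Ω : Type*} [MeasurableSpace Ω] {μ : Measure Ω}
    [IsProbabilityMeasure μ] {D : ℝ → Ω → ℝ} (hD : Measurable (Function.uncurry D)) {C : ℝ}
    (hC : ∀ s ω, |D s ω| ≤ C) {t : ℝ} (ht : 0 ≤ t)
    (horth : ∀ r s : ℝ, 0 ≤ r → r + t ≤ s → ∫ ω, D r ω * D s ω ∂μ = 0) :
    ∀ᵐ ω ∂μ, Tendsto (fun T : ℝ => T⁻¹ * ∫ s in (0 : ℝ)..T, D s ω) atTop (nhds 0) := by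
  let A : ℕ → Ω → ℝ := fun n ω => ((n : ℝ) ^ 2)⁻¹ * ∫ s in (0 : ℝ)..(n : ℝ) ^ 2, D s ω
  have hAmeas : ∀ n, Measurable (A n) := fun n => by
    simp only [A, intervalIntegral.integral_of_le (sq_nonneg (n : ℝ))]
    exact (hD.stronglyMeasurable.integral_prod_left'.measurable).const_mul _
  have hAbound : ∀ n ω, |A n ω| ≤ C := fun n ω => by
    have hC0 : 0 ≤ C := (abs_nonneg _).trans (hC 0 ω)
    have h1 : |∫ s in (0 : ℝ)..(n : ℝ) ^ 2, D s ω| ≤ C * |(n : ℝ) ^ 2 - 0| :=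
      abs_intervalIntegral_le_of_abs_le (fun s => hC s ω) _ _
    rw [sub_zero, abs_of_nonneg (sq_nonneg (n : ℝ))] at h1
    simp only [A]
    rw [abs_mul, abs_of_nonneg (by positivity), mul_comm, ← div_eq_mul_inv]
    exact div_le_of_le_mul₀ (by positivity) hC0 h1
  have hmoment : ∀ n, ∫⁻ ω, ENNReal.ofReal (A n ω ^ 2) ∂μ ≤
      ENNReal.ofReal (2 * t * C ^ 2 * (1 / (n : ℝ) ^ 2)) := fun n => by
    rw [← ofReal_integral_eq_lintegral_ofReal ?_ (ae_of_all _ fun ω => sq_nonneg _)]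
    · refine ENNReal.ofReal_le_ofReal ?_
      simp only [A, mul_pow]
      rw [integral_const_mul]
      calc _ ≤ (((n : ℝ) ^ 2)⁻¹) ^ 2 * (2 * t * C ^ 2 * (n : ℝ) ^ 2) := by
            gcongr
            exact integral_sq_intervalIntegral_le hD hC ht horth (sq_nonneg _)
        _ = _ := by
            rcases eq_or_ne (n : ℝ) 0 with h0 | h0
            · simp [h0]
            · field_simp
    · refine Integrable.of_bound ((hAmeas n).pow_const 2).aestronglyMeasurable (C ^ 2)
        (ae_of_all _ fun ω => ?_)
      rw [Real.norm_eq_abs, abs_pow]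
      gcongr
      exact hAbound n ω
  have hsum : ∑' n, ∫⁻ ω, ENNReal.ofReal (A n ω ^ 2) ∂μ ≠ ∞ :=
    ne_top_of_le_ne_top ((Real.summable_one_div_nat_pow.2 one_lt_two).mul_left
      (2 * t * C ^ 2)).tsum_ofReal_ne_top (ENNReal.tsum_le_tsum hmoment)
  have hfin : ∀ᵐ ω ∂μ, ∑' n, ENNReal.ofReal (A n ω ^ 2) < ∞ := by
    have hm : ∀ n, Measurable fun ω => ENNReal.ofReal (A n ω ^ 2) :=
      fun n => ((hAmeas n).pow_const 2).ennreal_ofReal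
    refine ae_lt_top (Measurable.tsum hm) ?_
    rwa [lintegral_tsum fun n => (hm n).aemeasurable]
  filter_upwards [hfin] with ω hω
  refine tendsto_average_zero_of_tendsto_sq (hD.comp measurable_prodMk_right) (fun s => hC s ω) ?_
  have h1 : Tendsto (fun n => ENNReal.ofReal (A n ω ^ 2)) atTop (nhds 0) :=
    Nat.cofinite_eq_atTop ▸ ENNReal.tendsto_cofinite_zero_of_tsum_ne_top hω.ne
  have h2 : Tendsto (fun n => A n ω ^ 2) atTop (nhds 0) := by
    have := (ENNReal.tendsto_toReal ENNReal.zero_ne_top).comp h1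
    simpa [Function.comp_def, ENNReal.toReal_ofReal (sq_nonneg _)] using this
  have h3 := (Real.continuous_sqrt.tendsto 0).comp h2
  rw [Real.sqrt_zero] at h3
  exact (tendsto_zero_iff_abs_tendsto_zero _).2
    (by simpa [Function.comp_def, Real.sqrt_sq_eq_abs, A] using h3)

/-- A measurable process with almost surely continuous paths on `[0, ∞)` agrees almost surely on
`[0, ∞)` with a measurable process all of whose paths are continuous. -/
lemma exists_continuous_modification {𝕏 Ω : Type*} [TopologicalSpace 𝕏] [MeasurableSpace 𝕏]
    [MeasurableSpace Ω] {μ : Measure Ω} [IsProbabilityMeasure μ] {X : ℝ → Ω → 𝕏}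
    (hX : ∀ t, 0 ≤ t → Measurable (X t))
    (hcont : ∀ᵐ ω ∂μ, ContinuousOn (fun t => X t ω) (Ici 0)) :
    ∃ Y : ℝ → Ω → 𝕏, (∀ ω, Continuous fun t => Y t ω) ∧ (∀ t, Measurable (Y t)) ∧
      ∀ᵐ ω ∂μ, ∀ t, 0 ≤ t → Y t ω = X t ω := by
  classical
  obtain ⟨ω₀⟩ : Nonempty Ω := nonempty_of_isProbabilityMeasure μ
  obtain ⟨S, hS, hSmeas, hS0⟩ := exists_measurable_superset_of_null (ae_iff.1 hcont)
  refine ⟨fun t ω => if ω ∈ S then X 0 ω₀ else X (max t 0) ω, fun ω => ?_, fun t => ?_, ?_⟩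
  · by_cases hω : ω ∈ S
    · simpa [hω] using continuous_const
    · have hc : ContinuousOn (fun t => X t ω) (Ici 0) := by
        by_contra hc
        exact hω (hS hc)
      simpa [hω, Function.comp_def] using hc.comp_continuous (continuous_id.max continuous_const)
        fun t => le_max_right t 0
  · exact Measurable.ite hSmeas measurable_const (hX _ (le_max_right _ _))
  · filter_upwards [measure_eq_zero_iff_ae_notMem.1 hS0] with ω hω t ht
    simp [hω, max_eq_left ht]

lemma abs_sub_le_norm_add_norm {𝕏 : Type*} [TopologicalSpace 𝕏] [CompactSpace 𝕏] (g h : C(𝕏, ℝ))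
    (x y : 𝕏) : |g x - h y| ≤ ‖g‖ + ‖h‖ :=
  (abs_sub _ _).trans <| add_le_add (g.norm_coe_le_norm x) (h.norm_coe_le_norm y)

/-- The increments `g (X_{s+t}) - E[g (X_{s+t}) | ℱ_s]` at times at least `t` apart are
uncorrelated. -/
lemma integral_mul_increment_eq_zero {𝕏 Ω : Type*} [TopologicalSpace 𝕏] [CompactSpace 𝕏]
    [MeasurableSpace 𝕏] [OpensMeasurableSpace 𝕏] {m0 : MeasurableSpace Ω} {μ : Measure Ω}
    [IsProbabilityMeasure μ] {ℱ : ℝ → MeasurableSpace Ω} (hle : ∀ t, ℱ t ≤ m0)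
    (hmono : Monotone ℱ) {X : ℝ → Ω → 𝕏} (hadp : ∀ t, 0 ≤ t → Measurable[ℱ t] (X t))
    {t : ℝ} (ht : 0 ≤ t) (g h : C(𝕏, ℝ))
    (hcond : ∀ s, 0 ≤ s → μ[fun ω => g (X (s + t) ω) | ℱ s] =ᵐ[μ] fun ω => h (X s ω))
    {r s : ℝ} (hr : 0 ≤ r) (hrs : r + t ≤ s) :
    ∫ ω, (g (X (r + t) ω) - h (X r ω)) * (g (X (s + t) ω) - h (X s ω)) ∂μ = 0 := by
  have hs : 0 ≤ s := by linarith
  have hmeas : ∀ (f : C(𝕏, ℝ)) (a b : ℝ), 0 ≤ a → a ≤ b → Measurable[ℱ b] fun ω => f (X a ω) :=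
    fun f a b ha hab => f.measurable.comp ((hadp a ha).mono (hmono hab) le_rfl)
  have hmeas0 : ∀ (f : C(𝕏, ℝ)) (a : ℝ), 0 ≤ a → Measurable fun ω => f (X a ω) :=
    fun f a ha => f.measurable.comp ((hadp a ha).mono (hle a) le_rfl)
  have hint : ∀ (f : C(𝕏, ℝ)) (a : ℝ), 0 ≤ a → Integrable (fun ω => f (X a ω)) μ :=
    fun f a ha => Integrable.of_bound (hmeas0 f a ha).aestronglyMeasurable ‖f‖
      (ae_of_all _ fun ω => f.norm_coe_le_norm _)
  set F : Ω → ℝ := fun ω => g (X (r + t) ω) - h (X r ω) with hF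
  set H : Ω → ℝ := (fun ω => g (X (s + t) ω)) - fun ω => h (X s ω) with hH
  have hFmeas : StronglyMeasurable[ℱ s] F := Measurable.stronglyMeasurable
    ((hmeas g _ _ (by positivity) hrs).sub (hmeas h _ _ hr (by linarith)))
  have hHint : Integrable H μ := (hint g _ (by positivity)).sub (hint h s hs)
  have hFH : Integrable (F * H) μ :=
    hHint.bdd_mul (c := ‖g‖ + ‖h‖) (hFmeas.mono (hle s)).aestronglyMeasurable
      (ae_of_all _ fun ω => abs_sub_le_norm_add_norm g h _ _)
  have hHzero : μ[H | ℱ s] =ᵐ[μ] 0 := by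
    have h1 : μ[fun ω => h (X s ω) | ℱ s] = fun ω => h (X s ω) :=
      condExp_of_stronglyMeasurable (hle s) (hmeas h s s hs le_rfl).stronglyMeasurable (hint h s hs)
    filter_upwards [condExp_sub (hint g (s + t) (by positivity)) (hint h s hs) (ℱ s),
      hcond s hs] with ω h2 h3
    rw [hH, h2, Pi.sub_apply, h3, h1, Pi.zero_apply, sub_self]
  calc ∫ ω, (g (X (r + t) ω) - h (X r ω)) * (g (X (s + t) ω) - h (X s ω)) ∂μ
      = ∫ ω, (μ[F * H | ℱ s]) ω ∂μ := (integral_condExp (hle s)).symm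
    _ = ∫ _, (0 : ℝ) ∂μ := by
        refine integral_congr_ae ?_
        filter_upwards [condExp_mul_of_stronglyMeasurable_left hFmeas hFH hHint, hHzero]
          with ω h1 h2
        rw [h1, Pi.mul_apply, h2, Pi.zero_apply, mul_zero]
    _ = 0 := integral_zero _ _

lemma pathEmpiricalMeasure_congr {𝕏 : Type*} [MeasurableSpace 𝕏] {x y : ℝ → 𝕏}
    (hxy : ∀ s, 0 ≤ s → x s = y s) (T : ℝ) :
    pathEmpiricalMeasure x T = pathEmpiricalMeasure y T := by
  rw [pathEmpiricalMeasure, pathEmpiricalMeasure, Measure.map_congr]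
  filter_upwards [ae_restrict_mem measurableSet_Icc] with s hs using hxy s hs.1

lemma integral_pathEmpiricalMeasure {𝕏 : Type*} [TopologicalSpace 𝕏]
    [MeasurableSpace 𝕏] [BorelSpace 𝕏] {x : ℝ → 𝕏} (hx : Continuous x)
    {f : 𝕏 → ℝ} (hf : StronglyMeasurable f) {T : ℝ} (hT : 0 ≤ T) :
    ∫ z, f z ∂(pathEmpiricalMeasure x T) = T⁻¹ * ∫ s in (0 : ℝ)..T, f (x s) := by
  rw [pathEmpiricalMeasure, integral_smul_measure,
    integral_map hx.measurable.aemeasurable hf.aestronglyMeasurable,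
    integral_Icc_eq_integral_Ioc, ← intervalIntegral.integral_of_le hT, ENNReal.toReal_inv,
    ENNReal.toReal_ofReal hT, smul_eq_mul]

/-- A shift in time does not change the asymptotic time averages of a bounded function. -/
lemma tendsto_average_shift_sub {f : ℝ → ℝ} (hf : Measurable f) {C : ℝ} (hC : ∀ s, |f s| ≤ C)
    (t : ℝ) :
    Tendsto (fun T : ℝ => T⁻¹ * ∫ s in (0 : ℝ)..T, (f (s + t) - f s)) atTop (nhds 0) := by
  have hlim : Tendsto (fun T : ℝ => T⁻¹ * (2 * (C * |t|))) atTop (nhds 0) := by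
    simpa using tendsto_inv_atTop_zero.mul_const (2 * (C * |t|))
  refine squeeze_zero_norm' ?_ hlim
  filter_upwards [eventually_ge_atTop 0] with T hT
  have hint := intervalIntegrable_of_abs_le hf hC
  have hshift : IntervalIntegrable (fun s => f (s + t)) volume 0 T :=
    intervalIntegrable_of_abs_le (hf.comp (measurable_add_const t)) (fun s => hC _) _ _
  have heq : ∫ s in (0 : ℝ)..T, (f (s + t) - f s) =
      (∫ s in T..T + t, f s) - ∫ s in (0 : ℝ)..t, f s := by
    rw [intervalIntegral.integral_sub hshift (hint _ _), intervalIntegral.integral_comp_add_right, zero_add,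
      intervalIntegral.integral_interval_sub_interval_comm (hint _ _) (hint _ _) (hint _ _),
      intervalIntegral.integral_symm t 0, intervalIntegral.integral_symm (T + t) T]
    ring
  have h1 := abs_intervalIntegral_le_of_abs_le hC T (T + t)
  have h2 := abs_intervalIntegral_le_of_abs_le hC 0 t
  rw [add_sub_cancel_left] at h1
  rw [sub_zero] at h2
  rw [heq, Real.norm_eq_abs, abs_mul, abs_of_nonneg (inv_nonneg.2 hT)]
  gcongr
  exact (abs_sub _ _).trans (by linarith)

/-- Along almost every path, the functions `g` and `h` have the same asymptotic time averages as
soon as `h (X_s) = E[g (X_{s+t}) | ℱ_s]` for all `s ≥ 0`. -/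
lemma ae_tendsto_average_sub_zero {𝕏 Ω : Type*} [MetricSpace 𝕏] [CompactSpace 𝕏]
    [MeasurableSpace 𝕏] [BorelSpace 𝕏] {m0 : MeasurableSpace Ω} {μ : Measure Ω}
    [IsProbabilityMeasure μ] {ℱ : ℝ → MeasurableSpace Ω} (hle : ∀ t, ℱ t ≤ m0)
    (hmono : Monotone ℱ) {X Y : ℝ → Ω → 𝕏} (hadp : ∀ t, 0 ≤ t → Measurable[ℱ t] (X t))
    (hYcont : ∀ ω, Continuous fun t => Y t ω) (hYmeas : ∀ t, Measurable (Y t))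
    (hYX : ∀ᵐ ω ∂μ, ∀ t, 0 ≤ t → Y t ω = X t ω) {t : ℝ} (ht : 0 ≤ t) (g h : C(𝕏, ℝ))
    (hcond : ∀ s, 0 ≤ s → μ[fun ω => g (X (s + t) ω) | ℱ s] =ᵐ[μ] fun ω => h (X s ω)) :
    ∀ᵐ ω ∂μ, Tendsto (fun T : ℝ => T⁻¹ * ∫ s in (0 : ℝ)..T, (h (Y s ω) - g (Y s ω))) atTop
      (nhds 0) := by
  have hY : Measurable (Function.uncurry Y) :=
    measurable_uncurry_of_continuous_of_measurable hYcont hYmeas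
  have hD : Measurable (Function.uncurry fun s ω => g (Y (s + t) ω) - h (Y s ω)) :=
    (g.measurable.comp (hY.comp ((measurable_fst.add_const t).prodMk measurable_snd))).sub
      (h.measurable.comp hY)
  filter_upwards [ae_tendsto_average_zero hD (fun s ω => abs_sub_le_norm_add_norm g h _ _) ht
    fun r s hr hrs => by
      rw [← integral_mul_increment_eq_zero hle hmono hadp ht g h hcond hr hrs]
      refine integral_congr_ae ?_
      filter_upwards [hYX] with ω hω
      rw [hω r hr, hω s (by linarith), hω (r + t) (by positivity), hω (s + t) (by linarith)]]
    with ω hω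
  have hm : ∀ f : C(𝕏, ℝ), Measurable fun s => f (Y s ω) :=
    fun f => (f.continuous.comp (hYcont ω)).measurable
  have hint : ∀ (f : C(𝕏, ℝ)) (c T : ℝ),
      IntervalIntegrable (fun s => f (Y (s + c) ω)) volume 0 T := fun f c T =>
    intervalIntegrable_of_abs_le ((hm f).comp (measurable_id.add_const c))
      (fun s => f.norm_coe_le_norm _) _ _
  have hdiff := (tendsto_average_shift_sub (hm g) (fun s => g.norm_coe_le_norm _) t).sub hω
  rw [sub_zero] at hdiff
  refine hdiff.congr fun T => ?_
  have hg0 := hint g 0 T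
  have hh0 := hint h 0 T
  simp only [add_zero] at hg0 hh0
  rw [intervalIntegral.integral_sub (hint g t T) hg0, intervalIntegral.integral_sub (hint g t T) hh0,
    intervalIntegral.integral_sub hh0 hg0]
  ring

/-- The time evolution of `P` is measurable at every point of the support of the law of `X_r`. -/
lemma measurable_integral_of_mem_support {𝕏 Ω : Type*} [MetricSpace 𝕏] [CompactSpace 𝕏]
    [MeasurableSpace 𝕏] [BorelSpace 𝕏] {m m0 : MeasurableSpace Ω} {μ : Measure Ω}
    [IsProbabilityMeasure μ] {Y : ℝ → Ω → 𝕏} (hY : Measurable (Function.uncurry Y))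
    {Z : Ω → 𝕏} (hm : m ≤ m0) (hZ : Measurable[m] Z)
    (g : C(𝕏, ℝ)) (p : ℝ → C(𝕏, ℝ))
    (hcond : ∀ t, μ[fun ω => g (Y t ω) | m] =ᵐ[μ] fun ω => p t (Z ω))
    {x : 𝕏} (hx : x ∈ (μ.map Z).support) : Measurable fun t => p t x := by
  have hZ0 : Measurable Z := hZ.mono hm le_rfl
  let A : ℕ → Set Ω := fun n => Z ⁻¹' Metric.ball x (1 / ((n : ℝ) + 1))
  have hA : ∀ n, MeasurableSet[m] (A n) := fun n => hZ Metric.isOpen_ball.measurableSet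
  have hApos : ∀ n, 0 < μ.real (A n) := fun n => by
    have h1 := (Measure.mem_support_iff_forall x).1 hx _
      (Metric.ball_mem_nhds x (Nat.one_div_pos_of_nat (α := ℝ) (n := n)))
    rw [Measure.map_apply hZ0 Metric.isOpen_ball.measurableSet] at h1
    exact ENNReal.toReal_pos h1.ne' (measure_ne_top _ _)
  have hYt : ∀ t, Measurable fun ω => g (Y t ω) := fun t =>
    g.measurable.comp (hY.comp measurable_prodMk_left)
  refine measurable_of_tendsto_metrizable
    (f := fun n t => (μ.real (A n))⁻¹ * ∫ ω in A n, g (Y t ω) ∂μ) (fun n => ?_)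
    (tendsto_pi_nhds.2 fun t => ?_)
  · exact ((g.measurable.comp hY).stronglyMeasurable.integral_prod_right'.measurable).const_mul _
  · have hset : ∀ n, ∫ ω in A n, g (Y t ω) ∂μ = ∫ ω in A n, p t (Z ω) ∂μ := fun n => by
      rw [← setIntegral_condExp hm (Integrable.of_bound (hYt t).aestronglyMeasurable ‖g‖
        (ae_of_all _ fun ω => g.norm_coe_le_norm _)) (hA n)]
      exact integral_congr_ae (ae_restrict_of_ae (hcond t))
    simp only [hset]
    rw [Metric.tendsto_atTop]
    intro ε hε
    obtain ⟨δ, hδ, hball⟩ := Metric.continuous_iff.1 (p t).continuous x (ε / 2) (half_pos hε)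
    obtain ⟨N, hN⟩ := exists_nat_one_div_lt hδ
    refine ⟨N, fun n hn => ?_⟩
    have hclose : ∀ ω ∈ A n, ‖p t (Z ω) - p t x‖ ≤ ε / 2 := fun ω hω =>
      (hball _ (lt_trans (lt_of_lt_of_le hω (Nat.one_div_le_one_div hn)) hN)).le
    have hint : Integrable (fun ω => p t (Z ω)) μ :=
      Integrable.of_bound ((p t).measurable.comp hZ0).aestronglyMeasurable ‖p t‖
        (ae_of_all _ fun ω => (p t).norm_coe_le_norm _)
    have hbound := norm_setIntegral_le_of_norm_le_const (μ := μ) (measure_lt_top _ _) hclose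
    rw [integral_sub hint.integrableOn (integrable_const _), setIntegral_const, smul_eq_mul] at hbound
    have heq : (μ.real (A n))⁻¹ * (∫ ω in A n, p t (Z ω) ∂μ) - p t x =
        (μ.real (A n))⁻¹ * ((∫ ω in A n, p t (Z ω) ∂μ) - μ.real (A n) * p t x) := by
      have := (hApos n).ne'
      field_simp
    rw [Real.dist_eq, heq, abs_mul, abs_of_pos (inv_pos.2 (hApos n))]
    calc _ ≤ (μ.real (A n))⁻¹ * (ε / 2 * μ.real (A n)) := by
          gcongr
          exact hbound
      _ = ε / 2 := by
          have := (hApos n).ne'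
          field_simp
      _ < ε := half_lt_self hε

/-- The points from which the evolution of a family of kernels is measurable in the time
parameter. -/
def timeMeasurablePoints {𝕏 : Type*} [TopologicalSpace 𝕏] [MeasurableSpace 𝕏]
    (P : ℝ → Kernel 𝕏 𝕏) : Set 𝕏 :=
  {x | ∀ g : C(𝕏, ℝ), Measurable fun t : ℝ => ∫ y, g y ∂(P (max t 0) x)}

lemma isClosed_timeMeasurablePoints {𝕏 : Type*} [MetricSpace 𝕏] [MeasurableSpace 𝕏]
    {P : ℝ → Kernel 𝕏 𝕏}
    (hFeller : ∀ (t : ℝ), 0 ≤ t → ∀ f : C(𝕏, ℝ), Continuous fun x => ∫ y, f y ∂(P t x)) :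
    IsClosed (timeMeasurablePoints P) := by
  refine IsSeqClosed.isClosed fun x a hx hxa g => ?_
  exact measurable_of_tendsto_metrizable (fun n => hx n g) (tendsto_pi_nhds.2 fun t =>
    ((hFeller _ (le_max_right t 0) g).tendsto a).comp hxa)

lemma measurable_integral_comp_of_ae_mem {𝕏 : Type*} [MetricSpace 𝕏] [CompactSpace 𝕏]
    [MeasurableSpace 𝕏] [BorelSpace 𝕏] {P : ℝ → Kernel 𝕏 𝕏} [∀ t, IsMarkovKernel (P t)]
    (hFeller : ∀ (t : ℝ), 0 ≤ t → ∀ f : C(𝕏, ℝ), Continuous fun x => ∫ y, f y ∂(P t x))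
    {ν : Measure 𝕏} [IsProbabilityMeasure ν] (hν : ∀ᵐ x ∂ν, x ∈ timeMeasurablePoints P)
    (g : C(𝕏, ℝ)) : Measurable fun t : ℝ => ∫ x, g x ∂(P (max t 0) ∘ₘ ν) := by
  have hG : MeasurableSet (timeMeasurablePoints P) :=
    (isClosed_timeMeasurablePoints hFeller).measurableSet
  have hjoint : Measurable (Function.uncurry
      fun (x : timeMeasurablePoints P) (t : ℝ) => ∫ y, g y ∂(P (max t 0) x)) :=
    measurable_uncurry_of_continuous_of_measurable
      (fun t => (hFeller _ (le_max_right t 0) g).comp continuous_subtype_val) fun x => x.2 g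
  have heq : ∀ t : ℝ, ∫ x, g x ∂(P (max t 0) ∘ₘ ν) =
      ∫ x : timeMeasurablePoints P, ∫ y, g y ∂(P (max t 0) x) ∂(ν.comap Subtype.val) := fun t => by
    rw [integral_subtype_comap hG fun x => ∫ y, g y ∂(P (max t 0) x),
      Measure.restrict_eq_self_of_ae_mem hν,
      integral_measure_comp (g.integrable_of_isFiniteMeasure _)]
  simp only [heq]
  exact hjoint.stronglyMeasurable.integral_prod_left'.measurable

/-- A weak limit point of the empirical measures of a path is carried by any closed set containing
the path. -/
lemma ae_mem_of_tendsto_pathEmpiricalMeasure {𝕏 : Type*} [MetricSpace 𝕏] [CompactSpace 𝕏]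
    [MeasurableSpace 𝕏] [BorelSpace 𝕏] {x : ℝ → 𝕏} (hx : Continuous x) {G : Set 𝕏}
    (hG : IsClosed G) (hxG : ∀ s, 0 ≤ s → x s ∈ G) {ν : Measure 𝕏} [IsProbabilityMeasure ν]
    {tk : ℕ → ℝ} (htk : Tendsto tk atTop atTop)
    (hν : ∀ f : C(𝕏, ℝ), Tendsto (fun k => ∫ z, f z ∂(pathEmpiricalMeasure x (tk k))) atTop
      (nhds (∫ z, f z ∂ν))) :
    ∀ᵐ z ∂ν, z ∈ G := by
  let f : C(𝕏, ℝ) := ⟨fun z => Metric.infDist z G, Metric.continuous_infDist_pt G⟩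
  have hzero : ∫ z, f z ∂ν = 0 := by
    refine tendsto_nhds_unique (hν f) (tendsto_const_nhds.congr' ?_)
    filter_upwards [htk.eventually_ge_atTop 0] with k hk
    rw [integral_pathEmpiricalMeasure hx f.continuous.measurable.stronglyMeasurable hk,
      intervalIntegral.integral_congr (g := fun _ => (0 : ℝ)) fun s hs => ?_,
      intervalIntegral.integral_zero, mul_zero]
    rw [uIcc_of_le hk] at hs
    exact Metric.infDist_zero_of_mem (hxG s hs.1)
  filter_upwards [(integral_eq_zero_iff_of_nonneg (fun z => Metric.infDist_nonneg)
    (f.integrable_of_isFiniteMeasure ν)).1 hzero] with z hz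
  exact (hG.mem_iff_infDist_zero ⟨x 0, hxG 0 le_rfl⟩).2 hz

/-- A continuous Markov process almost surely stays in the set of points from which the semigroup
is measurable in time. -/
lemma ae_forall_mem_timeMeasurablePoints {𝕏 Ω : Type*} [MetricSpace 𝕏] [CompactSpace 𝕏]
    [MeasurableSpace 𝕏] [BorelSpace 𝕏] {P : ℝ → Kernel 𝕏 𝕏}
    (hFeller : ∀ (t : ℝ), 0 ≤ t → ∀ f : C(𝕏, ℝ), Continuous fun x => ∫ y, f y ∂(P t x))
    {m0 : MeasurableSpace Ω} {μ : Measure Ω} [IsProbabilityMeasure μ] {ℱ : ℝ → MeasurableSpace Ω}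
    (hle : ∀ t, ℱ t ≤ m0) {X Y : ℝ → Ω → 𝕏} (hadp : ∀ t, 0 ≤ t → Measurable[ℱ t] (X t))
    (hYcont : ∀ ω, Continuous fun t => Y t ω) (hYmeas : ∀ t, Measurable (Y t))
    (hYX : ∀ᵐ ω ∂μ, ∀ t, 0 ≤ t → Y t ω = X t ω)
    (hcond : ∀ (g : C(𝕏, ℝ)) (s t : ℝ), 0 ≤ s → 0 ≤ t →
      μ[fun ω => g (X (t + s) ω) | ℱ t] =ᵐ[μ] fun ω => ∫ y, g y ∂(P s (X t ω))) :
    ∀ᵐ ω ∂μ, ∀ s, 0 ≤ s → Y s ω ∈ timeMeasurablePoints P := by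
  have hY : Measurable (Function.uncurry Y) :=
    measurable_uncurry_of_continuous_of_measurable hYcont hYmeas
  have hrat : ∀ q : ℚ, ∀ᵐ ω ∂μ, 0 ≤ (q : ℝ) → X q ω ∈ timeMeasurablePoints P := fun q => by
    by_cases hq : 0 ≤ (q : ℝ)
    · have hXq : Measurable (X q) := (hadp q hq).mono (hle q) le_rfl
      filter_upwards [ae_of_ae_map hXq.aemeasurable
        (Measure.support_mem_ae (μ := μ.map (X q)))] with ω hω _ g
      have hZ : Measurable (Function.uncurry fun (t : ℝ) ω => Y (q + max t 0) ω) :=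
        hY.comp ((((measurable_fst (α := ℝ) (β := Ω)).max measurable_const).const_add
          (q : ℝ)).prodMk measurable_snd)
      refine measurable_integral_of_mem_support hZ (hle q) (hadp q hq) g
        (fun t => ⟨fun x => ∫ y, g y ∂(P (max t 0) x), hFeller _ (le_max_right t 0) g⟩)
        (fun t => ?_) hω
      refine (condExp_congr_ae ?_).trans (hcond g (max t 0) q (le_max_right t 0) hq)
      filter_upwards [hYX] with ω hω
      rw [hω _ (add_nonneg hq (le_max_right t 0))]
    · exact ae_of_all _ fun ω h => absurd h hq
  filter_upwards [ae_all_iff.2 hrat, hYX] with ω hω hYXω s hs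
  have hdense : s ∈ closure (Ioi (0 : ℝ) ∩ range ((↑) : ℚ → ℝ)) :=
    closure_minimal (Rat.denseRange_cast.open_subset_closure_inter isOpen_Ioi) isClosed_closure
      (by rwa [closure_Ioi])
  refine closure_minimal (t := (fun t => Y t ω) ⁻¹' timeMeasurablePoints P) ?_
    ((isClosed_timeMeasurablePoints hFeller).preimage (hYcont ω)) hdense
  rintro _ ⟨hq, q, rfl⟩
  rw [mem_preimage, hYXω q (mem_Ioi.1 hq).le]
  exact hω q (mem_Ioi.1 hq).le

/-- Theorem 2.4 of the paper (Benaïm): for a Feller Markov process with continuous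
paths on a compact metric space, almost surely every weak limit point of the empirical
measures as `t → ∞` is an invariant probability measure of the semigroup. -/
theorem limit_points_of_empirical_measures_invariant
    {𝕏 : Type*} [MetricSpace 𝕏] [CompactSpace 𝕏]
    [MeasurableSpace 𝕏] [BorelSpace 𝕏]
    (P : ℝ → Kernel 𝕏 𝕏) (hMarkov : ∀ t, IsMarkovKernel (P t))
    (hP0 : P 0 = Kernel.id)
    (hsemigroup : ∀ s t : ℝ, 0 ≤ s → 0 ≤ t → P (t + s) = (P t) ∘ₖ (P s))
    (hFeller : ∀ (t : ℝ), 0 ≤ t → ∀ f : C(𝕏, ℝ),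
      Continuous fun x => ∫ y, f y ∂(P t x))
    {Ω : Type*} [m0 : MeasurableSpace Ω] (μ : Measure Ω) [IsProbabilityMeasure μ]
    (ℱ : ℝ → MeasurableSpace Ω) (hle : ∀ t, ℱ t ≤ m0) (hmono : Monotone ℱ)
    (X : ℝ → Ω → 𝕏)
    (hadp : ∀ t, 0 ≤ t → Measurable[ℱ t] (X t))
    (hcont : ∀ᵐ ω ∂μ, ContinuousOn (fun t => X t ω) (Set.Ici 0))
    (hMarkovProp : ∀ (f : 𝕏 → ℝ), Measurable f → (∃ C, ∀ x, |f x| ≤ C) →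
      ∀ s t : ℝ, 0 ≤ s → 0 ≤ t →
        μ[fun ω => f (X (t + s) ω) | ℱ t]
          =ᵐ[μ] fun ω => ∫ y, f y ∂(P s (X t ω))) :
    ∀ᵐ ω ∂μ, ∀ ν : Measure 𝕏, IsProbabilityMeasure ν →
      (∃ tk : ℕ → ℝ, Tendsto tk atTop atTop ∧
        ∀ f : C(𝕏, ℝ),
          Tendsto (fun k => ∫ x, f x ∂(pathEmpiricalMeasure (fun s => X s ω) (tk k)))
            atTop (nhds (∫ x, f x ∂ν))) →
      ∀ t : ℝ, 0 ≤ t → ∀ A : Set 𝕏, MeasurableSet A →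
        ∫⁻ x, (P t) x A ∂ν = ν A := by
  have hX : ∀ t, 0 ≤ t → Measurable (X t) := fun t ht => (hadp t ht).mono (hle t) le_rfl
  obtain ⟨Y, hYcont, hYmeas, hYX⟩ := exists_continuous_modification hX hcont
  have hcond : ∀ (g : C(𝕏, ℝ)) (s t : ℝ), 0 ≤ s → 0 ≤ t →
      μ[fun ω => g (X (t + s) ω) | ℱ t] =ᵐ[μ] fun ω => ∫ y, g y ∂(P s (X t ω)) :=
    fun g => hMarkovProp g g.continuous.measurable ⟨‖g‖, g.norm_coe_le_norm⟩
  have haverage : ∀ (q : ℚ) (n : ℕ), ∀ᵐ ω ∂μ, 0 ≤ (q : ℝ) → Tendsto (fun T : ℝ =>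
      T⁻¹ * ∫ s in (0 : ℝ)..T, ((∫ y, TopologicalSpace.denseSeq C(𝕏, ℝ) n y ∂(P q (Y s ω))) -
        TopologicalSpace.denseSeq C(𝕏, ℝ) n (Y s ω))) atTop (nhds 0) := fun q n => by
    by_cases hq : 0 ≤ (q : ℝ)
    · filter_upwards [ae_tendsto_average_sub_zero hle hmono hadp hYcont hYmeas hYX hq
        (TopologicalSpace.denseSeq C(𝕏, ℝ) n) ⟨_, hFeller q hq _⟩
        fun s hs => hcond _ q s hq hs] with ω hω _ using hω
    · exact ae_of_all _ fun ω h => absurd h hq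
  filter_upwards [hYX, ae_all_iff.2 fun q => ae_all_iff.2 (haverage q),
    ae_forall_mem_timeMeasurablePoints hFeller hle hadp hYcont hYmeas hYX hcond]
    with ω hYXω havg hmem
  rintro ν hν ⟨tk, htk, hlim⟩ t ht A hA
  have hlimY : ∀ f : C(𝕏, ℝ), Tendsto
      (fun k => ∫ x, f x ∂(pathEmpiricalMeasure (fun s => Y s ω) (tk k))) atTop
      (nhds (∫ x, f x ∂ν)) := fun f => by
    simpa only [pathEmpiricalMeasure_congr hYXω] using hlim f
  have hrat : ∀ q : ℚ, 0 ≤ q → P q ∘ₘ ν = ν := fun q hq => by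
    have hq' : (0 : ℝ) ≤ q := by exact_mod_cast hq
    refine ext_of_integral_denseSeq_eq fun n => ?_
    set g := TopologicalSpace.denseSeq C(𝕏, ℝ) n
    let h : C(𝕏, ℝ) := ⟨fun x => ∫ y, g y ∂(P q x), hFeller q hq' g⟩
    rw [integral_measure_comp (g.integrable_of_isFiniteMeasure _), ← sub_eq_zero]
    refine tendsto_nhds_unique ((hlimY h).sub (hlimY g))
      (((havg q n hq').comp htk).congr' ?_)
    filter_upwards [htk.eventually_ge_atTop 0] with k hk
    have hint : ∀ f : C(𝕏, ℝ), IntervalIntegrable (fun s => f (Y s ω)) volume 0 (tk k) :=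
      fun f => (f.continuous.comp (hYcont ω)).intervalIntegrable _ _
    rw [integral_pathEmpiricalMeasure (hYcont ω) h.continuous.measurable.stronglyMeasurable hk,
      integral_pathEmpiricalMeasure (hYcont ω) g.continuous.measurable.stronglyMeasurable hk,
      ← mul_sub, ← intervalIntegral.integral_sub (hint h) (hint g)]
    rfl
  have hνG := ae_mem_of_tendsto_pathEmpiricalMeasure (hYcont ω)
    (isClosed_timeMeasurablePoints hFeller) hmem htk hlimY
  have hinv := comp_eq_of_rational_invariant P hsemigroup ν hrat
    (measurable_integral_comp_of_ae_mem hFeller hνG) ht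
  rw [← Measure.bind_apply hA (P t).aemeasurable, hinv]
end
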